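/- arXiv:math/0101266 — 2 statements merged into one kernel-verified Lean document; each statement's English description precedes it below -/
import Mathlib

section
/- Let $(V, \omega)$ be a real symplectic vector space of dimension $2m$, i.e. $V$ is a $2m$-dimensional real vector space and $\omega$ is a nondegenerate alternating bilinear form on $V$, regarded as an element of $\Lambda^2 V^*$. Then for every $0 \leq p \leq m$, the linear map $\Lambda^p V^* \to \Lambda^{2m-p} V^*$ given by $\alpha \mapsto \omega^{m-p} \wedge \alpha$ is a linear isomorphism; in particular $\Lambda^p V^* \cong \Lambda^{2m-p} V^*$. -/
open Module

set_option synthInstance.maxHeartbeats 1000000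
set_option maxHeartbeats 1000000

variable {V : Type*} [AddCommGroup V] [Module ℝ V] [FiniteDimensional ℝ V]

/-- The element of `Λ² V*` (inside the exterior algebra of the dual space) corresponding to an
alternating bilinear form `B` on `V`: in terms of a basis `(b_i)` with dual basis `(b*_i)`,
it is `(1/2) ∑_{i,j} B(b_i, b_j) b*_i ∧ b*_j`. -/
noncomputable def omegaElem (B : LinearMap.BilinForm ℝ V) :
    ExteriorAlgebra ℝ (Module.Dual ℝ V) :=
  (2⁻¹ : ℝ) • ∑ i, ∑ j,
    B (Module.finBasis ℝ V i) (Module.finBasis ℝ V j) •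
      (ExteriorAlgebra.ι ℝ ((Module.finBasis ℝ V).dualBasis i) *
        ExteriorAlgebra.ι ℝ ((Module.finBasis ℝ V).dualBasis j))

/-- The space `Π^p = {α ∈ Λ^p V* : ω^{m-p+1} ∧ α = 0}` of primitive `p`-forms on a
symplectic vector space `(V, B)` of dimension `2m`. -/
noncomputable def primForms (B : LinearMap.BilinForm ℝ V) (m p : ℕ) :
    Submodule ℝ (ExteriorAlgebra ℝ (Module.Dual ℝ V)) :=
  ⋀[ℝ]^p (Module.Dual ℝ V) ⊓
    LinearMap.ker (LinearMap.mulLeft ℝ (omegaElem B ^ (m - p + 1)))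


/-- contraction with a vector -/
noncomputable def ctr (v : V) :
    ExteriorAlgebra ℝ (Module.Dual ℝ V) →ₗ[ℝ] ExteriorAlgebra ℝ (Module.Dual ℝ V) :=
  CliffordAlgebra.contractLeft (Q := (0 : QuadraticForm ℝ (Module.Dual ℝ V)))
    (Module.Dual.eval ℝ V v)

local notation "ιd" => ExteriorAlgebra.ι ℝ (M := Module.Dual ℝ V)

theorem ctr_ι_mul (v : V) (a : Module.Dual ℝ V) (b : ExteriorAlgebra ℝ (Module.Dual ℝ V)) :
    ctr v (ιd a * b) = a v • b - ιd a * ctr v b :=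
  CliffordAlgebra.contractLeft_ι_mul _ a b

theorem ι_anti (a b : Module.Dual ℝ V) : ιd a * ιd b = - (ιd b * ιd a) :=
  eq_neg_of_add_eq_zero_left (ExteriorAlgebra.ι_add_mul_swap a b)

theorem ctr_add (v w : V) : ctr (v + w) = ctr v + ctr w := by
  simp [ctr]

theorem ctr_smul (c : ℝ) (w : V) : ctr (c • w) = c • ctr w := by
  simp [ctr]

/-- contraction, bundled -/
noncomputable def ctrL : V →ₗ[ℝ] ExteriorAlgebra ℝ (Module.Dual ℝ V) →ₗ[ℝ]
    ExteriorAlgebra ℝ (Module.Dual ℝ V) where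
  toFun := ctr
  map_add' := ctr_add
  map_smul' := ctr_smul

theorem ctr_zero (v : V) (α : ExteriorAlgebra ℝ (Module.Dual ℝ V))
    (h : α ∈ ⋀[ℝ]^0 (Module.Dual ℝ V)) : ctr v α = 0 := by
  rw [ExteriorAlgebra.exteriorPower, pow_zero] at h
  obtain ⟨r, rfl⟩ := Submodule.mem_one.1 h
  exact CliffordAlgebra.contractLeft_algebraMap _ _ r

theorem ctr_succ (v : V) (p : ℕ) : ∀ (α : ExteriorAlgebra ℝ (Module.Dual ℝ V))
    (_ : α ∈ ⋀[ℝ]^(p+1) (Module.Dual ℝ V)), ctr v α ∈ ⋀[ℝ]^p (Module.Dual ℝ V) := by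
  induction p with
  | zero =>
    intro α h
    rw [ExteriorAlgebra.exteriorPower, pow_succ'] at h
    refine Submodule.mul_induction_on h ?_ (fun x y hx hy => by
      rw [map_add]; exact add_mem hx hy)
    rintro _ ⟨a, rfl⟩ b hb
    rw [ctr_ι_mul, ctr_zero v b hb, mul_zero, sub_zero]
    exact Submodule.smul_mem _ _ hb
  | succ p ih =>
    intro α h
    rw [ExteriorAlgebra.exteriorPower, pow_succ'] at h
    refine Submodule.mul_induction_on h ?_ (fun x y hx hy => by
      rw [map_add]; exact add_mem hx hy)
    rintro _ ⟨a, rfl⟩ b hb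
    rw [ctr_ι_mul]
    refine sub_mem (Submodule.smul_mem _ _ hb) ?_
    rw [ExteriorAlgebra.exteriorPower, pow_succ']
    exact Submodule.mul_mem_mul ⟨a, rfl⟩ (ih b hb)

theorem ι_expand {n : ℕ} (b : Basis (Fin n) ℝ V) (a : Module.Dual ℝ V) :
    ιd a = ∑ i, a (b i) • ιd (b.dualBasis i) := by
  have h : a = ∑ i, a (b i) • b.dualBasis i := by
    simp [Basis.sum_dual_apply_smul_coord]
  conv_lhs => rw [h, map_sum]
  exact Finset.sum_congr rfl fun i _ => map_smul _ _ _

theorem vec_expand {n : ℕ} (b : Basis (Fin n) ℝ V) (B : LinearMap.BilinForm ℝ V) (v w : V) :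
    B v w = ∑ i, B (b i) w * b.dualBasis i v := by
  conv_lhs => rw [← b.sum_repr v, map_sum, LinearMap.sum_apply]
  refine Finset.sum_congr rfl fun i _ => ?_
  rw [map_smul, LinearMap.smul_apply, smul_eq_mul, mul_comm]
  simp

theorem euler_mul (a : Module.Dual ℝ V) (b : ExteriorAlgebra ℝ (Module.Dual ℝ V)) :
    ∑ i, ιd ((Module.finBasis ℝ V).dualBasis i) * ctr (Module.finBasis ℝ V i) (ιd a * b) =
    ιd a * b + ιd a * ∑ i, ιd ((Module.finBasis ℝ V).dualBasis i) *
      ctr (Module.finBasis ℝ V i) b := by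
  have ha := ι_expand (Module.finBasis ℝ V) a
  conv_rhs => enter [1]; rw [ha]
  rw [Finset.sum_mul, Finset.mul_sum, ← Finset.sum_add_distrib]
  refine Finset.sum_congr rfl fun i _ => ?_
  rw [ctr_ι_mul, mul_sub, ← mul_assoc, ← mul_assoc, ι_anti a, mul_smul_comm, smul_mul_assoc]
  simp [sub_eq_add_neg]

theorem euler (p : ℕ) : ∀ (α : ExteriorAlgebra ℝ (Module.Dual ℝ V))
    (_ : α ∈ ⋀[ℝ]^p (Module.Dual ℝ V)),
    ∑ i, ιd ((Module.finBasis ℝ V).dualBasis i) * ctr (Module.finBasis ℝ V i) α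
      = (p : ℝ) • α := by
  induction p with
  | zero =>
    intro α h
    simp [ctr_zero _ α h]
  | succ p ih =>
    intro α h
    rw [ExteriorAlgebra.exteriorPower, pow_succ'] at h
    refine Submodule.mul_induction_on h ?_ (fun x y hx hy => by
      simp only [map_add, mul_add, Finset.sum_add_distrib, hx, hy, smul_add])
    rintro _ ⟨a, rfl⟩ b hb
    rw [euler_mul, ih b hb, mul_smul_comm]
    push_cast
    rw [add_smul, one_smul, add_comm]

theorem ctr_omega (B : LinearMap.BilinForm ℝ V) (halt : B.IsAlt) (v : V)
    (α : ExteriorAlgebra ℝ (Module.Dual ℝ V)) :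
    ctr v (omegaElem B * α) = ιd (B v) * α + omegaElem B * ctr v α := by
  set b := Module.finBasis ℝ V with hb
  have h1 : ∑ i, ∑ j, B (b i) (b j) • (b.dualBasis i v • ιd (b.dualBasis j)) = ιd (B v) := by
    rw [ι_expand b (B v), Finset.sum_comm]
    refine Finset.sum_congr rfl fun j _ => ?_
    rw [vec_expand b B v, Finset.sum_smul]
    simp only [smul_smul]
  have h2 : ∑ i, ∑ j, B (b i) (b j) • (b.dualBasis j v • ιd (b.dualBasis i)) = - ιd (B v) := by
    rw [← h1, Finset.sum_comm, ← Finset.sum_neg_distrib]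
    refine Finset.sum_congr rfl fun j _ => ?_
    rw [← Finset.sum_neg_distrib]
    refine Finset.sum_congr rfl fun i _ => ?_
    rw [← halt.neg_eq (b j) (b i), neg_smul]
  have h3 : ctr v (omegaElem B * α) = (2⁻¹ : ℝ) •
      ((∑ i, ∑ j, B (b i) (b j) • (b.dualBasis i v • ιd (b.dualBasis j))) * α
      - (∑ i, ∑ j, B (b i) (b j) • (b.dualBasis j v • ιd (b.dualBasis i))) * α)
      + omegaElem B * ctr v α := by
    rw [omegaElem, ← hb, smul_mul_assoc, smul_mul_assoc, map_smul, ← smul_add]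
    congr 1
    simp only [Finset.sum_mul, map_sum, ← Finset.sum_sub_distrib, ← Finset.sum_add_distrib]
    refine Finset.sum_congr rfl fun i _ => Finset.sum_congr rfl fun j _ => ?_
    simp only [smul_mul_assoc, map_smul, ← smul_sub, ← smul_add, mul_assoc, ctr_ι_mul,
      mul_sub, mul_smul_comm]
    congr 1
    abel
  rw [h3, h1, h2, neg_mul, sub_neg_eq_add, ← two_smul ℝ, smul_smul]
  norm_num

/-- the dual Lefschetz operator -/
noncomputable def lam (B : LinearMap.BilinForm ℝ V) (hnd : B.Nondegenerate) :
    ExteriorAlgebra ℝ (Module.Dual ℝ V) →ₗ[ℝ] ExteriorAlgebra ℝ (Module.Dual ℝ V) :=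
  (2⁻¹ : ℝ) • ∑ i, ctr (Module.finBasis ℝ V i) ∘ₗ
    ctr ((B.toDual hnd).symm ((Module.finBasis ℝ V).dualBasis i))

theorem lam_omega (m : ℕ) (hdim : finrank ℝ V = 2 * m)
    (B : LinearMap.BilinForm ℝ V) (halt : B.IsAlt) (hnd : B.Nondegenerate) (p : ℕ)
    (α : ExteriorAlgebra ℝ (Module.Dual ℝ V)) (hα : α ∈ ⋀[ℝ]^p (Module.Dual ℝ V)) :
    lam B hnd (omegaElem B * α) = omegaElem B * lam B hnd α + ((m : ℝ) - p) • α := by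
  set b := Module.finBasis ℝ V with hb
  set f := fun i => (B.toDual hnd).symm (b.dualBasis i) with hf
  have hBf : ∀ i, B (f i) = b.dualBasis i := fun i => by
    ext w
    rw [← LinearMap.BilinForm.toDual_def hnd]
    simp [f]
  have hw : ∀ j, ∑ i, B (b i) (b j) • f i = - b j := fun j => by
    apply (B.toDual hnd).injective
    ext w
    rw [LinearMap.BilinForm.toDual_def, LinearMap.BilinForm.toDual_def]
    simp only [map_sum, map_smul, hBf, map_neg, LinearMap.neg_apply, halt.neg_eq,
      LinearMap.sum_apply, LinearMap.smul_apply]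
    rw [vec_expand b B w]
    rfl
  have h4 : ∑ i, ιd (B (b i)) * ctr (f i) α = - ((p : ℝ) • α) := by
    rw [← euler p α hα, ← hb, ← Finset.sum_neg_distrib]
    have : ∀ i, ιd (B (b i)) * ctr (f i) α =
        ∑ j, ιd (b.dualBasis j) * (ctrL (B (b i) (b j) • f i) α) := fun i => by
      rw [ι_expand b (B (b i)), Finset.sum_mul]
      refine Finset.sum_congr rfl fun j _ => ?_
      simp [ctrL]
    simp_rw [this]
    rw [Finset.sum_comm]
    refine Finset.sum_congr rfl fun j _ => ?_
    rw [← Finset.mul_sum, ← LinearMap.sum_apply, ← map_sum, hw j, map_neg]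
    simp [ctrL]
  have h5 : lam B hnd (omegaElem B * α) = (2⁻¹ : ℝ) • (∑ i : Fin (finrank ℝ V), α -
      ∑ i, ιd (b.dualBasis i) * ctr (b i) α + ∑ i, ιd (B (b i)) * ctr (f i) α)
      + omegaElem B * lam B hnd α := by
    simp only [lam, ← hb, LinearMap.smul_apply, LinearMap.sum_apply, LinearMap.comp_apply,
      mul_smul_comm, ← smul_add]
    congr 1
    rw [Finset.mul_sum, ← Finset.sum_sub_distrib, ← Finset.sum_add_distrib,
      ← Finset.sum_add_distrib]
    refine Finset.sum_congr rfl fun i _ => ?_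
    change ctr (b i) (ctr (f i) _) = _ + omegaElem B * (ctr (b i) (ctr (f i) _))
    rw [ctr_omega B halt, map_add, ctr_omega B halt, hBf, ctr_ι_mul]
    simp
    abel
  rw [h5, h4, euler p α hα, add_comm]
  congr 1
  simp only [Finset.sum_const, Finset.card_univ, Fintype.card_fin, hdim]
  rw [← Nat.cast_smul_eq_nsmul ℝ]
  push_cast
  module

theorem omega_mem (B : LinearMap.BilinForm ℝ V) : omegaElem B ∈ ⋀[ℝ]^2 (Module.Dual ℝ V) := by
  refine Submodule.smul_mem _ _ (Submodule.sum_mem _ fun i _ => Submodule.sum_mem _ fun j _ =>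
    Submodule.smul_mem _ _ ?_)
  rw [ExteriorAlgebra.exteriorPower, pow_two]
  exact Submodule.mul_mem_mul ⟨_, rfl⟩ ⟨_, rfl⟩

theorem omega_pow_mem (B : LinearMap.BilinForm ℝ V) (k p : ℕ)
    (α : ExteriorAlgebra ℝ (Module.Dual ℝ V)) (hα : α ∈ ⋀[ℝ]^p (Module.Dual ℝ V)) :
    omegaElem B ^ k * α ∈ ⋀[ℝ]^(2 * k + p) (Module.Dual ℝ V) := by
  rw [ExteriorAlgebra.exteriorPower, pow_add, pow_mul]
  exact Submodule.mul_mem_mul (Submodule.pow_mem_pow _ (omega_mem B) k) hα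

theorem lam_omega_pow (m : ℕ) (hdim : finrank ℝ V = 2 * m)
    (B : LinearMap.BilinForm ℝ V) (halt : B.IsAlt) (hnd : B.Nondegenerate) (p : ℕ)
    (α : ExteriorAlgebra ℝ (Module.Dual ℝ V)) (hα : α ∈ ⋀[ℝ]^p (Module.Dual ℝ V)) (k : ℕ) :
    lam B hnd (omegaElem B ^ (k+1) * α) = omegaElem B ^ (k+1) * lam B hnd α +
      (((k : ℝ) + 1) * ((m : ℝ) - p - k)) • (omegaElem B ^ k * α) := by
  induction k with
  | zero =>
    simpa using lam_omega m hdim B halt hnd p α hα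
  | succ k ih =>
    rw [pow_succ', mul_assoc, lam_omega m hdim B halt hnd _ _ (omega_pow_mem B (k+1) p α hα), ih,
      mul_add, ← mul_assoc, mul_smul_comm, ← mul_assoc, ← pow_succ', ← pow_succ', add_assoc,
      ← add_smul]
    congr 2
    push_cast
    ring

theorem lam_low (B : LinearMap.BilinForm ℝ V) (hnd : B.Nondegenerate) (p : ℕ) (hp : p < 2)
    (α : ExteriorAlgebra ℝ (Module.Dual ℝ V)) (hα : α ∈ ⋀[ℝ]^p (Module.Dual ℝ V)) :
    lam B hnd α = 0 := by
  simp only [lam, LinearMap.smul_apply, LinearMap.sum_apply, LinearMap.comp_apply]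
  rw [Finset.sum_eq_zero, smul_zero]
  intro i _
  interval_cases p
  · rw [ctr_zero _ α hα, map_zero]
  · exact ctr_zero _ _ (ctr_succ _ 0 α hα)

theorem lam_mem (B : LinearMap.BilinForm ℝ V) (hnd : B.Nondegenerate) (p : ℕ)
    (α : ExteriorAlgebra ℝ (Module.Dual ℝ V)) (hα : α ∈ ⋀[ℝ]^(p+2) (Module.Dual ℝ V)) :
    lam B hnd α ∈ ⋀[ℝ]^p (Module.Dual ℝ V) := by
  simp only [lam, LinearMap.smul_apply, LinearMap.sum_apply, LinearMap.comp_apply]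
  exact Submodule.smul_mem _ _ (Submodule.sum_mem _ fun i _ =>
    ctr_succ _ _ _ (ctr_succ _ _ _ hα))

theorem omega_inj (m : ℕ) (hdim : finrank ℝ V = 2 * m)
    (B : LinearMap.BilinForm ℝ V) (halt : B.IsAlt) (hnd : B.Nondegenerate) (p : ℕ) :
    ∀ (k : ℕ) (_ : k + p ≤ m) (α : ExteriorAlgebra ℝ (Module.Dual ℝ V))
    (_ : α ∈ ⋀[ℝ]^p (Module.Dual ℝ V)) (_ : omegaElem B ^ k * α = 0), α = 0 := by
  induction p using Nat.strong_induction_on with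
  | _ p ihp =>
  intro k
  induction k with
  | zero => intro _ α _ h; simpa using h
  | succ k ihk =>
    intro hk α hα h
    have hc : (((k : ℝ) + 1) * ((m : ℝ) - p - k)) ≠ 0 := by
      have : (k : ℝ) + 1 + p ≤ m := by exact_mod_cast hk
      have h1 : (0 : ℝ) < m - p - k := by linarith
      positivity
    set c := (((k : ℝ) + 1) * ((m : ℝ) - p - k))
    have key := lam_omega_pow m hdim B halt hnd p α hα k
    rw [h, map_zero] at key
    by_cases hp : p < 2
    · rw [lam_low B hnd p hp α hα, mul_zero, zero_add] at key
      exact ihk (by omega) α hα ((smul_eq_zero.1 key.symm).resolve_left hc)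
    · obtain ⟨q, rfl⟩ : ∃ q, p = q + 2 := ⟨p - 2, by omega⟩
      have hl := lam_mem B hnd q α hα
      have h6 : omegaElem B * lam B hnd α + c • α = 0 := by
        refine ihk (by omega) _ ?_ ?_
        · refine add_mem ?_ (Submodule.smul_mem _ _ hα)
          have := omega_pow_mem B 1 q _ hl
          rwa [pow_one, mul_one, add_comm] at this
        · rw [mul_add, ← mul_assoc, ← pow_succ, mul_smul_comm]
          exact key.symm
      have h7 : lam B hnd α = 0 := by
        refine ihp q (by omega) (k+2) (by omega) _ hl ?_
        have : omegaElem B ^ (k+1) * (omegaElem B * lam B hnd α + c • α) = 0 := by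
          rw [h6, mul_zero]
        rwa [mul_add, ← mul_assoc, ← pow_succ, mul_smul_comm, h, smul_zero, add_zero] at this
      rw [h7, mul_zero, zero_add] at h6
      exact (smul_eq_zero.1 h6).resolve_left hc

/-- Let `(V, B)` be a real symplectic vector space of dimension `2m` (so `B` is a nondegenerate
alternating bilinear form, with corresponding `ω ∈ Λ² V*`). For every `0 ≤ p ≤ m`, the linear
map `Λ^p V* → Λ^{2m-p} V*`, `α ↦ ω^{m-p} ∧ α`, is a linear isomorphism: it is injective on
`Λ^p V*` and its image is exactly `Λ^{2m-p} V*`; in particular `Λ^p V* ≅ Λ^{2m-p} V*`. -/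
theorem wedge_omega_pow_isomorphism (m : ℕ) (hdim : finrank ℝ V = 2 * m)
    (B : LinearMap.BilinForm ℝ V) (halt : B.IsAlt) (hnd : B.Nondegenerate)
    (p : ℕ) (hp : p ≤ m) :
    Submodule.map (LinearMap.mulLeft ℝ (omegaElem B ^ (m - p)))
        (⋀[ℝ]^p (Module.Dual ℝ V)) = ⋀[ℝ]^(2 * m - p) (Module.Dual ℝ V) ∧
    ∀ α ∈ ⋀[ℝ]^p (Module.Dual ℝ V), omegaElem B ^ (m - p) * α = 0 → α = 0 := by
  have hinj : ∀ α ∈ ⋀[ℝ]^p (Module.Dual ℝ V), omegaElem B ^ (m - p) * α = 0 → α = 0 :=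
    fun α hα h => omega_inj m hdim B halt hnd p (m - p) (by omega) α hα h
  refine ⟨?_, hinj⟩
  have hle : Submodule.map (LinearMap.mulLeft ℝ (omegaElem B ^ (m - p)))
        (⋀[ℝ]^p (Module.Dual ℝ V)) ≤ ⋀[ℝ]^(2 * m - p) (Module.Dual ℝ V) := by
    rintro _ ⟨α, hα, rfl⟩
    have := omega_pow_mem B (m - p) p α hα
    rwa [show 2 * (m - p) + p = 2 * m - p by omega] at this
  refine Submodule.eq_of_le_of_finrank_eq hle ?_
  have h1 : finrank ℝ (Submodule.map (LinearMap.mulLeft ℝ (omegaElem B ^ (m - p)))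
        (⋀[ℝ]^p (Module.Dual ℝ V))) = finrank ℝ (⋀[ℝ]^p (Module.Dual ℝ V)) := by
    rw [← LinearMap.range_domRestrict]
    refine LinearMap.finrank_range_of_inj ?_
    rw [← LinearMap.ker_eq_bot, LinearMap.ker_eq_bot']
    rintro ⟨α, hα⟩ h
    exact Subtype.ext (hinj α hα h)
  rw [h1, exteriorPower.finrank_eq, exteriorPower.finrank_eq, Subspace.dual_finrank_eq, hdim]
  exact (Nat.choose_symm (by omega)).symm
end

section
/- Let $(V, \omega)$ be a real symplectic vector space of dimension $2m$, and for $0 \leq p \leq m$ let $\Pi^p = \{\alpha \in \Lambda^p V^* : \omega^{m-p+1} \wedge \alpha = 0\}$ be the space of primitive $p$-forms. Then $\dim_{\mathbb{R}} \Pi^p = \binom{2m}{p} - \binom{2m}{p-2}$ for all $0 \leq p \leq m$ (where $\binom{2m}{p-2} = 0$ if $p < 2$). -/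
open Module

set_option synthInstance.maxHeartbeats 1000000
set_option maxHeartbeats 1000000

variable {V : Type*} [AddCommGroup V] [Module ℝ V] [FiniteDimensional ℝ V]

namespace PrimAux

open ExteriorAlgebra

/-- interior product -/
noncomputable def ip (v : V) : ExteriorAlgebra ℝ (Module.Dual ℝ V) →ₗ[ℝ] ExteriorAlgebra ℝ (Module.Dual ℝ V) :=
  CliffordAlgebra.contractLeft (Q := (0 : QuadraticForm ℝ (Module.Dual ℝ V))) (Module.Dual.eval ℝ V v)

theorem ip_ι_mul (v : V) (f : Module.Dual ℝ V) (x : (ExteriorAlgebra ℝ (Module.Dual ℝ V))) :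
    ip v (ι ℝ f * x) = f v • x - ι ℝ f * ip v x :=
  CliffordAlgebra.contractLeft_ι_mul (Q := (0 : QuadraticForm ℝ (Module.Dual ℝ V))) _ _ _

theorem ip_one (v : V) : ip v (1 : (ExteriorAlgebra ℝ (Module.Dual ℝ V))) = 0 :=
  CliffordAlgebra.contractLeft_one (Q := (0 : QuadraticForm ℝ (Module.Dual ℝ V))) _

theorem ip_algebraMap (v : V) (r : ℝ) : ip v (algebraMap ℝ (ExteriorAlgebra ℝ (Module.Dual ℝ V)) r) = 0 := by
  rw [Algebra.algebraMap_eq_smul_one, map_smul, ip_one, smul_zero]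

theorem ι_swap (f g : Module.Dual ℝ V) : (ι ℝ f * ι ℝ g : (ExteriorAlgebra ℝ (Module.Dual ℝ V))) = - (ι ℝ g * ι ℝ f) := by
  rw [eq_neg_iff_add_eq_zero]; exact ι_add_mul_swap f g

theorem ι_ι_comm (f g h : Module.Dual ℝ V) :
    (ι ℝ f * ι ℝ g) * ι ℝ h = (ι ℝ h * (ι ℝ f * ι ℝ g) : (ExteriorAlgebra ℝ (Module.Dual ℝ V))) := by
  rw [mul_assoc, ι_swap g h, mul_neg, ← mul_assoc, ι_swap f h, neg_mul, neg_neg, mul_assoc]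

theorem omega_comm (B : LinearMap.BilinForm ℝ V) (h : Module.Dual ℝ V) :
    Commute (omegaElem B) (ι ℝ h) := by
  unfold omegaElem
  apply Commute.smul_left
  refine Commute.sum_left _ _ _ fun i _ => Commute.sum_left _ _ _ fun j _ => ?_
  exact Commute.smul_left (ι_ι_comm _ _ _) _

theorem dual_expand (f : Module.Dual ℝ V) :
    ∑ i, f (finBasis ℝ V i) • (finBasis ℝ V).dualBasis i = f := by
  have := (finBasis ℝ V).sum_dual_apply_smul_coord f
  simpa using this

theorem ip_omega_mul (B : LinearMap.BilinForm ℝ V) (halt : B.IsAlt) (v : V) (x : (ExteriorAlgebra ℝ (Module.Dual ℝ V))) :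
    ip v (omegaElem B * x) = ι ℝ (B v) * x + omegaElem B * ip v x := by
  have key : ∀ f g : Module.Dual ℝ V, ip v (ι ℝ f * ι ℝ g * x) =
      f v • (ι ℝ g * x) - g v • (ι ℝ f * x) + ι ℝ f * ι ℝ g * ip v x := by
    intro f g
    rw [mul_assoc, ip_ι_mul, ip_ι_mul, mul_sub, mul_smul_comm, mul_assoc]; abel
  have hv := (finBasis ℝ V).sum_repr v
  have h1 : ∑ i, ∑ j, B (finBasis ℝ V i) (finBasis ℝ V j) •
      (((finBasis ℝ V).dualBasis i v) • (ι ℝ ((finBasis ℝ V).dualBasis j) * x)) = ι ℝ (B v) * x := by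
    rw [Finset.sum_comm]
    conv_rhs => rw [← dual_expand (B v)]
    rw [map_sum, Finset.sum_mul]
    refine Finset.sum_congr rfl fun j _ => ?_
    simp only [smul_smul, ← Finset.sum_smul]
    rw [map_smul, smul_mul_assoc]
    congr 1
    have hB : B v (finBasis ℝ V j) =
        B (∑ i, (finBasis ℝ V).repr v i • finBasis ℝ V i) (finBasis ℝ V j) := by rw [hv]
    rw [hB, map_sum, LinearMap.sum_apply]
    refine Finset.sum_congr rfl fun i _ => ?_
    simp [mul_comm]
  have h2 : ∑ i, ∑ j, B (finBasis ℝ V i) (finBasis ℝ V j) •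
      (((finBasis ℝ V).dualBasis j v) • (ι ℝ ((finBasis ℝ V).dualBasis i) * x)) = - (ι ℝ (B v) * x) := by
    rw [← h1, Finset.sum_comm, ← Finset.sum_neg_distrib]
    refine Finset.sum_congr rfl fun i _ => ?_
    rw [← Finset.sum_neg_distrib]
    refine Finset.sum_congr rfl fun j _ => ?_
    rw [← halt.neg_eq, neg_smul]
  have h3 : ∑ i, ∑ j, B (finBasis ℝ V i) (finBasis ℝ V j) • 
     (ι ℝ ((finBasis ℝ V).dualBasis i) * ι ℝ ((finBasis ℝ V).dualBasis j) * ip v x)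
      = (2:ℝ) • (omegaElem B * ip v x) := by
    simp [omegaElem, smul_smul, Finset.sum_mul]
  have h4 : omegaElem B * x = (2⁻¹ : ℝ) • ∑ i, ∑ j, B (finBasis ℝ V i) (finBasis ℝ V j) • 
     (ι ℝ ((finBasis ℝ V).dualBasis i) * ι ℝ ((finBasis ℝ V).dualBasis j) * x) := by
    simp [omegaElem, Finset.sum_mul]
  rw [h4]
  simp only [map_smul, map_sum, key, smul_add, smul_sub, Finset.sum_add_distrib, Finset.sum_sub_distrib]
  rw [← smul_sub, ← smul_add, h1, h2, h3]
  module

theorem ip_omega_pow_mul (B : LinearMap.BilinForm ℝ V) (halt : B.IsAlt) (v : V) (r : ℕ) (x : (ExteriorAlgebra ℝ (Module.Dual ℝ V))) :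
    ip v (omegaElem B ^ (r+1) * x) =
      ((r+1 : ℕ) : ℝ) • (ι ℝ (B v) * (omegaElem B ^ r * x)) + omegaElem B ^ (r+1) * ip v x := by
  induction r with
  | zero => simp [ip_omega_mul B halt]
  | succ r ih =>
    rw [pow_succ' _ (r+1), mul_assoc, ip_omega_mul B halt, ih, mul_add, mul_smul_comm,
      ← mul_assoc (omegaElem B) (ι ℝ (B v)), (omega_comm B (B v)).eq, mul_assoc (ι ℝ (B v)),
      ← mul_assoc (omegaElem B) (_ ^ r), ← pow_succ', ← mul_assoc (omegaElem B) (_ ^ (r+1))]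
    push_cast
    module

theorem euler_ι_mul (f : Module.Dual ℝ V) (x : (ExteriorAlgebra ℝ (Module.Dual ℝ V))) :
    ∑ i, ι ℝ ((finBasis ℝ V).dualBasis i) * ip (finBasis ℝ V i) (ι ℝ f * x) =
      ι ℝ f * x + ι ℝ f * ∑ i, ι ℝ ((finBasis ℝ V).dualBasis i) * ip (finBasis ℝ V i) x := by
  simp only [ip_ι_mul, mul_sub, Finset.sum_sub_distrib]
  have : ∑ i, ι ℝ ((finBasis ℝ V).dualBasis i) * (f (finBasis ℝ V i) • x) = ι ℝ f * x := by
    conv_rhs => rw [← dual_expand f, map_sum, Finset.sum_mul]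
    refine Finset.sum_congr rfl fun i _ => ?_
    rw [map_smul, smul_mul_assoc, mul_smul_comm]
  rw [this, sub_eq_add_neg, ← Finset.sum_neg_distrib, Finset.mul_sum]
  congr 1
  refine Finset.sum_congr rfl fun i _ => ?_
  rw [← mul_assoc, ι_swap, neg_mul, neg_neg, mul_assoc]

theorem euler (k : ℕ) (x : (ExteriorAlgebra ℝ (Module.Dual ℝ V))) (hx : x ∈ ⋀[ℝ]^k (Module.Dual ℝ V)) :
    ∑ i, ι ℝ ((finBasis ℝ V).dualBasis i) * ip (finBasis ℝ V i) x = (k : ℝ) • x := by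
  induction hx using Submodule.pow_induction_on_left' with
  | algebraMap r => simp [ip_algebraMap]
  | add x y i hx hy h1 h2 => simp only [map_add, mul_add, Finset.sum_add_distrib, h1, h2, smul_add]
  | mem_mul m hm i x hx ih =>
    obtain ⟨f, rfl⟩ := hm
    rw [euler_ι_mul, ih, mul_smul_comm]
    push_cast; module

theorem ι_mul_mem (k : ℕ) (f : Module.Dual ℝ V) (x : (ExteriorAlgebra ℝ (Module.Dual ℝ V))) (hx : x ∈ ⋀[ℝ]^k (Module.Dual ℝ V)) :
    ι ℝ f * x ∈ ⋀[ℝ]^(k+1) (Module.Dual ℝ V) := by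
  rw [exteriorPower, pow_succ']
  exact Submodule.mul_mem_mul ⟨f, rfl⟩ hx

theorem ip_mem (v : V) (k : ℕ) (x : (ExteriorAlgebra ℝ (Module.Dual ℝ V))) (hx : x ∈ ⋀[ℝ]^k (Module.Dual ℝ V)) :
    ip v x ∈ ⋀[ℝ]^(k-1) (Module.Dual ℝ V) ∧ (k = 0 → ip v x = 0) := by
  induction hx using Submodule.pow_induction_on_left' with
  | algebraMap r => simp [ip_algebraMap]
  | add x y i hx hy h1 h2 =>
    rw [map_add]
    exact ⟨add_mem h1.1 h2.1, fun h => by rw [h1.2 h, h2.2 h, add_zero]⟩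
  | mem_mul m hm i x hx ih =>
    obtain ⟨f, rfl⟩ := hm
    refine ⟨?_, by simp⟩
    rw [ip_ι_mul]
    refine sub_mem (Submodule.smul_mem _ _ hx) ?_
    rcases i with _ | i
    · rw [ih.2 rfl, mul_zero]; exact zero_mem _
    · exact ι_mul_mem i f _ ih.1

theorem omega_mem (B : LinearMap.BilinForm ℝ V) : omegaElem B ∈ ⋀[ℝ]^2 (Module.Dual ℝ V) := by
  unfold omegaElem
  refine Submodule.smul_mem _ _ (sum_mem fun i _ => sum_mem fun j _ => Submodule.smul_mem _ _ ?_)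
  rw [exteriorPower, pow_two]
  exact Submodule.mul_mem_mul ⟨_, rfl⟩ ⟨_, rfl⟩

theorem omega_pow_mul_mem (B : LinearMap.BilinForm ℝ V) (r k : ℕ) (x : (ExteriorAlgebra ℝ (Module.Dual ℝ V)))
    (hx : x ∈ ⋀[ℝ]^k (Module.Dual ℝ V)) :
    omegaElem B ^ r * x ∈ ⋀[ℝ]^(2 * r + k) (Module.Dual ℝ V) := by
  rw [exteriorPower, pow_add, pow_mul]
  exact Submodule.mul_mem_mul (Submodule.pow_mem_pow _ (omega_mem B) r) hx

theorem exists_vec (B : LinearMap.BilinForm ℝ V) (hnd : B.Nondegenerate) (f : Module.Dual ℝ V) :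
    ∃ v, B v = f := ⟨(B.toDual hnd).symm f, by ext w; simp⟩

theorem omega_pow_ne (m : ℕ) (hdim : finrank ℝ V = 2 * m)
    (B : LinearMap.BilinForm ℝ V) (halt : B.IsAlt) (hnd : B.Nondegenerate) (r : ℕ) (hr : r ≤ m) :
    omegaElem B ^ r ≠ 0 := by
  induction r with
  | zero => simp
  | succ r ih =>
    intro h0
    apply ih (by omega)
    have h1 : ∀ f : Module.Dual ℝ V, ι ℝ f * omegaElem B ^ r = 0 := by
      intro f
      obtain ⟨v, rfl⟩ := exists_vec B hnd f
      have := ip_omega_pow_mul B halt v r 1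
      rw [ip_one, mul_one, mul_one, h0, map_zero, mul_zero, add_zero] at this
      exact (smul_eq_zero.mp this.symm).resolve_left (by positivity)
    have h2 := euler (2 * r) (omegaElem B ^ r) (by simpa using omega_pow_mul_mem B r 0 1 (by simp [exteriorPower]))
    have h3 : ∀ i, ι ℝ ((finBasis ℝ V).dualBasis i) * ip (finBasis ℝ V i) (omegaElem B ^ r) = omegaElem B ^ r := by
      intro i
      have := ip_ι_mul (finBasis ℝ V i) ((finBasis ℝ V).dualBasis i) (omegaElem B ^ r)
      rw [h1, map_zero] at this
      rw [← sub_eq_zero.mp this.symm]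
      simp
    simp only [h3, Finset.sum_const, Finset.card_univ, Fintype.card_fin, hdim] at h2
    rw [← Nat.cast_smul_eq_nsmul ℝ, ← sub_eq_zero, ← sub_smul] at h2
    refine (smul_eq_zero.mp h2).resolve_left ?_
    rw [sub_eq_zero]
    exact_mod_cast (by omega : 2 * m ≠ 2 * r)

theorem lefschetz (m : ℕ) (hdim : finrank ℝ V = 2 * m)
    (B : LinearMap.BilinForm ℝ V) (halt : B.IsAlt) (hnd : B.Nondegenerate) (k r : ℕ) (hr : r + k ≤ m)
    (x : (ExteriorAlgebra ℝ (Module.Dual ℝ V))) (hx : x ∈ ⋀[ℝ]^k (Module.Dual ℝ V)) (h0 : omegaElem B ^ r * x = 0) : x = 0 := by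
  induction k generalizing r x with
  | zero =>
    rw [exteriorPower, pow_zero, Submodule.mem_one] at hx
    obtain ⟨c, rfl⟩ := hx
    rw [Algebra.algebraMap_eq_smul_one, mul_smul_comm, mul_one] at h0
    rw [(smul_eq_zero.mp h0).resolve_right (omega_pow_ne m hdim B halt hnd r (by omega)), map_zero]
  | succ k ih =>
    have h1 : ∀ v : V, ip v x = 0 := by
      intro v
      refine ih (r+1) (by omega) _ (ip_mem v _ x hx).1 ?_
      have := ip_omega_pow_mul B halt v r x
      rw [h0, pow_succ', mul_assoc, h0] at this
      simpa [pow_succ', mul_assoc] using this.symm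
    have h2 := euler _ x hx
    simp only [h1, mul_zero, Finset.sum_const_zero] at h2
    exact (smul_eq_zero.mp h2.symm).resolve_left (by positivity)

theorem finrank_ext (m : ℕ) (hdim : finrank ℝ V = 2 * m) (k : ℕ) :
    finrank ℝ (⋀[ℝ]^k (Module.Dual ℝ V)) = (2 * m).choose k := by
  rw [exteriorPower.finrank_eq, Subspace.dual_finrank_eq, hdim]

theorem map_eq (m : ℕ) (hdim : finrank ℝ V = 2 * m)
    (B : LinearMap.BilinForm ℝ V) (halt : B.IsAlt) (hnd : B.Nondegenerate) (k : ℕ) (hk : k ≤ m) :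
    (⋀[ℝ]^k (Module.Dual ℝ V)).map (LinearMap.mulLeft ℝ (omegaElem B ^ (m - k))) =
      ⋀[ℝ]^(2 * m - k) (Module.Dual ℝ V) := by
  apply Submodule.eq_of_le_of_finrank_eq
  · rintro _ ⟨x, hx, rfl⟩
    have := omega_pow_mul_mem B (m - k) k x hx
    rwa [show 2 * (m - k) + k = 2 * m - k by omega] at this
  · rw [finrank_ext m hdim, Nat.choose_symm (by omega), ← finrank_ext m hdim,
      ← LinearMap.range_domRestrict]
    apply LinearMap.finrank_range_of_inj
    rw [← LinearMap.ker_eq_bot, LinearMap.ker_eq_bot']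
    rintro ⟨x, hx⟩ h
    exact Subtype.ext (lefschetz m hdim B halt hnd k (m-k) (by omega) x hx h)

theorem finrank_map (m : ℕ) (hdim : finrank ℝ V = 2 * m)
    (B : LinearMap.BilinForm ℝ V) (halt : B.IsAlt) (hnd : B.Nondegenerate) (p : ℕ) (hp : p ≤ m) :
    finrank ℝ ((⋀[ℝ]^p (Module.Dual ℝ V)).map (LinearMap.mulLeft ℝ (omegaElem B ^ (m - p + 1)))) =
      (if 2 ≤ p then Nat.choose (2 * m) (p - 2) else 0) := by
  have hle : (⋀[ℝ]^p (Module.Dual ℝ V)).map (LinearMap.mulLeft ℝ (omegaElem B ^ (m - p + 1))) ≤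
      ⋀[ℝ]^(2 * m + 2 - p) (Module.Dual ℝ V) := by
    rintro _ ⟨x, hx, rfl⟩
    have := omega_pow_mul_mem B (m - p + 1) p x hx
    rwa [show 2 * (m - p + 1) + p = 2 * m + 2 - p by omega] at this
  split_ifs with h2
  · obtain ⟨k, rfl⟩ := Nat.exists_eq_add_of_le' h2
    rw [show k + 2 - 2 = k by omega, ← Nat.choose_symm (by omega), ← finrank_ext m hdim]
    have e : (⋀[ℝ]^(k+2) (Module.Dual ℝ V)).map
        (LinearMap.mulLeft ℝ (omegaElem B ^ (m - (k+2) + 1))) = ⋀[ℝ]^(2 * m - k) (Module.Dual ℝ V) := by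
      apply le_antisymm
      · rwa [show 2 * m + 2 - (k+2) = 2 * m - k by omega] at hle
      · rw [← map_eq m hdim B halt hnd k (by omega)]
        rintro _ ⟨x, hx, rfl⟩
        refine ⟨omegaElem B * x, ?_, ?_⟩
        · have := omega_pow_mul_mem B 1 k x hx
          rwa [pow_one, show 2 * 1 + k = k + 2 by omega] at this
        · simp only [LinearMap.mulLeft_apply]
          rw [← mul_assoc, ← pow_succ, show m - (k+2) + 1 + 1 = m - k by omega]
    rw [e]
  · have := Submodule.finrank_mono hle
    rw [finrank_ext m hdim, Nat.choose_eq_zero_of_lt (by omega)] at this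
    omega

end PrimAux

/-- Let `(V, B)` be a real symplectic vector space of dimension `2m`, and for `0 ≤ p ≤ m` let
`Π^p = {α ∈ Λ^p V* : ω^{m-p+1} ∧ α = 0}` be the space of primitive `p`-forms. Then
`dim Π^p = C(2m, p) - C(2m, p-2)` (where the second binomial coefficient is `0` if `p < 2`). -/
theorem primForms_finrank (m : ℕ) (hdim : finrank ℝ V = 2 * m)
    (B : LinearMap.BilinForm ℝ V) (halt : B.IsAlt) (hnd : B.Nondegenerate)
    (p : ℕ) (hp : p ≤ m) :
    finrank ℝ (primForms B m p) =
      Nat.choose (2 * m) p - (if 2 ≤ p then Nat.choose (2 * m) (p - 2) else 0) := by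
  have h := LinearMap.finrank_range_add_finrank_ker
    ((LinearMap.mulLeft ℝ (omegaElem B ^ (m - p + 1))).domRestrict (⋀[ℝ]^p (Module.Dual ℝ V)))
  rw [LinearMap.range_domRestrict, PrimAux.finrank_map m hdim B halt hnd p hp,
    PrimAux.finrank_ext m hdim] at h
  have e : finrank ℝ (primForms B m p) = finrank ℝ (LinearMap.ker
      ((LinearMap.mulLeft ℝ (omegaElem B ^ (m - p + 1))).domRestrict (⋀[ℝ]^p (Module.Dual ℝ V)))) := by
    rw [LinearMap.ker_domRestrict, ← Submodule.finrank_map_subtype_eq]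
    rw [Submodule.map_comap_subtype]
    rfl
  omega
end
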